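/- (Sensitivity as a quadratic form in one core) Let A : Fin I₁ → Matrix (Fin R₁) (Fin R₂) ℝ, B : Fin I₂ → Matrix (Fin R₂) (Fin R₃) ℝ, C : Fin I₃ → Matrix (Fin R₃) (Fin R₁) ℝ be core families. Set G = ∑_{j} (B j) * (B j)ᵀ (an R₂ × R₂ matrix) and H = ∑_{k} (C k)ᵀ * (C k) (an R₁ × R₁ matrix), and let Q : Matrix (Fin R₂ × Fin R₁) (Fin R₂ × Fin R₁) ℝ be Q = I₂ • (1_{R₂} ⊗ₖ H) + I₃ • (G ⊗ₖ 1_{R₁}), where ⊗ₖ is the Kronecker product and 1 denotes identity matrices. For each i, let vec(A i) : Fin R₂ × Fin R₁ → ℝ be given by vec(A i) (r₂, r₁) = A i r₁ r₂. Then I₂ * ∑_{k,i} ‖C k * A i‖_F² + I₃ * ∑_{i,j} ‖A i * B j‖_F² = ∑_{i} (vec(A i)) ᵀ Q (vec(A i)), i.e., the part of the TC sensitivity that depends on A is the quadratic form with matrix Q applied to the vectorized slices of A. -/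

import Mathlib

open scoped BigOperators Matrix Kronecker

/-- Squared Frobenius norm of a real matrix. -/
def matFrobSq {n m : ℕ} (M : Matrix (Fin n) (Fin m) ℝ) : ℝ :=
  ∑ i, ∑ j, (M i j) ^ 2

section

open Matrix

theorem matFrobSq_eq_vec_dotProduct_vec {n m : ℕ} (M : Matrix (Fin n) (Fin m) ℝ) :
    matFrobSq M = vec M ⬝ᵥ vec M := by
  simp only [matFrobSq, dotProduct, vec, Fintype.sum_prod_type, sq]
  exact Finset.sum_comm

theorem matFrobSq_mul_left {l m n : ℕ} (L : Matrix (Fin l) (Fin m) ℝ)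
    (M : Matrix (Fin m) (Fin n) ℝ) :
    matFrobSq (L * M) = vec M ⬝ᵥ ((1 : Matrix (Fin n) (Fin n) ℝ) ⊗ₖ (Lᵀ * L)) *ᵥ vec M := by
  rw [matFrobSq_eq_vec_dotProduct_vec, kronecker_mulVec_vec, vec_dotProduct_vec,
    vec_dotProduct_vec, transpose_mul, transpose_one]
  simp only [Matrix.mul_assoc, Matrix.mul_one]

theorem matFrobSq_mul_right {m n l : ℕ} (M : Matrix (Fin m) (Fin n) ℝ)
    (N : Matrix (Fin n) (Fin l) ℝ) :
    matFrobSq (M * N) = vec M ⬝ᵥ ((N * Nᵀ) ⊗ₖ (1 : Matrix (Fin m) (Fin m) ℝ)) *ᵥ vec M := by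
  rw [matFrobSq_eq_vec_dotProduct_vec, kronecker_mulVec_vec, vec_dotProduct_vec,
    vec_dotProduct_vec, transpose_mul, transpose_mul, transpose_transpose, Matrix.mul_assoc,
    trace_mul_comm]
  simp only [Matrix.mul_assoc, Matrix.one_mul]

theorem sum_matFrobSq_mul_left {p l m n : ℕ} (L : Fin p → Matrix (Fin l) (Fin m) ℝ)
    (M : Matrix (Fin m) (Fin n) ℝ) :
    ∑ k, matFrobSq (L k * M) =
      vec M ⬝ᵥ ((1 : Matrix (Fin n) (Fin n) ℝ) ⊗ₖ ∑ k, (L k)ᵀ * L k) *ᵥ vec M := by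
  simp only [matFrobSq_mul_left, ← dotProduct_sum, ← sum_mulVec]
  congr 2
  exact (map_sum (kroneckerBilinear (R := ℝ) (1 : Matrix (Fin n) (Fin n) ℝ)) _ _).symm

theorem sum_matFrobSq_mul_right {p m n l : ℕ} (M : Matrix (Fin m) (Fin n) ℝ)
    (N : Fin p → Matrix (Fin n) (Fin l) ℝ) :
    ∑ j, matFrobSq (M * N j) =
      vec M ⬝ᵥ ((∑ j, N j * (N j)ᵀ) ⊗ₖ (1 : Matrix (Fin m) (Fin m) ℝ)) *ᵥ vec M := by
  simp only [matFrobSq_mul_right, ← dotProduct_sum, ← sum_mulVec]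
  congr 2
  exact (map_sum ((kroneckerBilinear (R := ℝ)).flip (1 : Matrix (Fin m) (Fin m) ℝ)) _ _).symm

end

/-- (Sensitivity as a quadratic form in one core) The part of the TC
sensitivity depending on the core `A` equals the quadratic form with matrix
`Q = I₂ • (1 ⊗ₖ H) + I₃ • (G ⊗ₖ 1)` applied to the vectorized slices of `A`,
where `G = ∑ⱼ B j (B j)ᵀ` and `H = ∑ₖ (C k)ᵀ (C k)`. -/
theorem tc_sensitivity_quadratic_form_in_core
    {I₁ I₂ I₃ R₁ R₂ R₃ : ℕ}
    (A : Fin I₁ → Matrix (Fin R₁) (Fin R₂) ℝ)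
    (B : Fin I₂ → Matrix (Fin R₂) (Fin R₃) ℝ)
    (C : Fin I₃ → Matrix (Fin R₃) (Fin R₁) ℝ)
    (G : Matrix (Fin R₂) (Fin R₂) ℝ) (hG : G = ∑ j, B j * (B j)ᵀ)
    (H : Matrix (Fin R₁) (Fin R₁) ℝ) (hH : H = ∑ k, (C k)ᵀ * C k)
    (Q : Matrix (Fin R₂ × Fin R₁) (Fin R₂ × Fin R₁) ℝ)
    (hQ : Q = (I₂ : ℝ) • ((1 : Matrix (Fin R₂) (Fin R₂) ℝ) ⊗ₖ H) +
      (I₃ : ℝ) • (G ⊗ₖ (1 : Matrix (Fin R₁) (Fin R₁) ℝ)))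
    (vecA : Fin I₁ → (Fin R₂ × Fin R₁ → ℝ))
    (hvecA : ∀ i r₂ r₁, vecA i (r₂, r₁) = A i r₁ r₂) :
    (I₂ : ℝ) * ∑ k, ∑ i, matFrobSq (C k * A i) +
      (I₃ : ℝ) * ∑ i, ∑ j, matFrobSq (A i * B j) =
    ∑ i, vecA i ⬝ᵥ Q.mulVec (vecA i) := by
  have hvec : vecA = fun i => (A i).vec := by
    ext i ⟨r₂, r₁⟩
    exact hvecA i r₂ r₁
  subst hvec hQ hG hH
  rw [Finset.sum_comm]
  simp only [sum_matFrobSq_mul_left, sum_matFrobSq_mul_right, Matrix.add_mulVec,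
    Matrix.smul_mulVec, dotProduct_add, dotProduct_smul, smul_eq_mul, Finset.sum_add_distrib,
    Finset.mul_sum]
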